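/- Let q = p^s with p > 3 prime, and let α ∈ F_q with α ≠ 2 and α ≠ −2. Then the polynomial f(x) = x³ + 3αx² + (3α² − 3)x + (α³ − 4α) is dynamically irreducible over F_q if and only if −3(α² − 4) is a nonzero square in F_q and, for δ in a fixed algebraic closure Ω of F_q with δ² = α² − 4 and a fixed square root √−3 ∈ Ω of −3, neither of the two roots (α + δ)/2 and (α − δ)/2 of x² − αx + 1 is a cube in the subfield F_q(√−3) of Ω. -/

import Mathlib

open Polynomial

/-- The `n`-fold composition `f ∘ f ∘ ... ∘ f` (`n` times) of a polynomial,
with `f^0 = X` (the identity). -/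
noncomputable def polyIter {K : Type*} [Field K] (f : K[X]) : ℕ → K[X]
  | 0 => X
  | n + 1 => f.comp (polyIter f n)

open IntermediateField in
/-- In an extension of odd degree generated by `z`, the element `z + z⁻¹` is also a generator. -/
theorem natDegree_minpoly_add_inv {F L : Type*} [Field F] [Field L] [Algebra F L]
    [FiniteDimensional F L] {z : L} (hz : z ≠ 0) (htop : F⟮z⟯ = ⊤)
    (hodd : Odd (Module.finrank F L)) :
    (minpoly F (z + z⁻¹)).natDegree = Module.finrank F L := by
  set M := F⟮z + z⁻¹⟯
  have htower := Module.finrank_mul_finrank F M L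
  have hM : Module.finrank F M = (minpoly F (z + z⁻¹)).natDegree :=
    adjoin.finrank (IsIntegral.of_finite F _)
  have htop' : M⟮z⟯ = ⊤ := adjoin_eq_top_of_adjoin_eq_top F htop
  have hL : Module.finrank M L = (minpoly M z).natDegree := by
    rw [← adjoin.finrank (IsIntegral.of_finite M z), htop', finrank_top']
  let y : M := ⟨z + z⁻¹, mem_adjoin_simple_self F _⟩
  have hdeg : (X ^ 2 - C y * X + 1 : M[X]).natDegree = 2 := by compute_degree!
  have hne : (X ^ 2 - C y * X + 1 : M[X]) ≠ 0 := ne_zero_of_natDegree_gt (n := 0) (by omega)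
  have hroot : aeval z (X ^ 2 - C y * X + 1 : M[X]) = 0 := by
    have : algebraMap M L y = z + z⁻¹ := rfl
    simp only [map_add, map_sub, map_mul, map_pow, aeval_X, aeval_C, map_one, this]
    field_simp
    ring
  have hle : Module.finrank M L ≤ 2 := by
    rw [hL, ← hdeg]
    exact natDegree_le_of_dvd (minpoly.dvd M z hroot) hne
  rw [← htower] at hodd
  obtain ⟨k, hk⟩ := (Nat.odd_mul.mp hodd).2
  have h1 : Module.finrank M L = 1 := by omega
  rw [← htower, h1, mul_one, hM]

/-- The Dickson polynomial `X ^ 3 - 3 * X`, conjugated by the translation by `a`. -/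
noncomputable def shiftedDickson {F : Type*} [Field F] (a : F) : F[X] :=
  X ^ 3 + C (3 * a) * X ^ 2 + C (3 * a ^ 2 - 3) * X + C (a ^ 3 - 4 * a)

theorem natDegree_shiftedDickson {F : Type*} [Field F] (a : F) :
    (shiftedDickson a).natDegree = 3 := by
  unfold shiftedDickson
  compute_degree!

theorem monic_shiftedDickson {F : Type*} [Field F] (a : F) : (shiftedDickson a).Monic := by
  unfold shiftedDickson
  monicity!

theorem aeval_shiftedDickson {F L : Type*} [Field F] [Field L] [Algebra F L] (a : F) (y : L) :
    aeval (y - algebraMap F L a) (shiftedDickson a) = y ^ 3 - 3 * y - algebraMap F L a := by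
  simp only [shiftedDickson, map_add, map_sub, map_mul, map_pow, aeval_X, aeval_C, map_ofNat]
  ring

theorem map_polyIter {F E : Type*} [Field F] [Field E] (φ : F →+* E) (f : F[X]) (n : ℕ) :
    (polyIter f n).map φ = polyIter (f.map φ) n := by
  induction n with
  | zero => simp [polyIter]
  | succ n ih => rw [polyIter, polyIter, Polynomial.map_comp, ih]

theorem natDegree_polyIter {F : Type*} [Field F] (f : F[X]) (n : ℕ) :
    (polyIter f n).natDegree = f.natDegree ^ n := by
  induction n with
  | zero => simp [polyIter]
  | succ n ih => rw [polyIter, natDegree_comp, ih, pow_succ']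

theorem monic_polyIter {F : Type*} [Field F] {f : F[X]} (hf : f.Monic) (hdeg : f.natDegree ≠ 0)
    (n : ℕ) : (polyIter f n).Monic := by
  induction n with
  | zero => exact monic_X
  | succ n ih =>
    refine hf.comp ih ?_
    rw [natDegree_polyIter]
    exact pow_ne_zero n hdeg

theorem aeval_polyIter_shiftedDickson {F L : Type*} [Field F] [Field L] [Algebra F L] (a : F)
    {z : L} (hz : z ≠ 0) (n : ℕ) :
    aeval (z + z⁻¹ - algebraMap F L a) (polyIter (shiftedDickson a) n) =
      z ^ 3 ^ n + (z ^ 3 ^ n)⁻¹ - algebraMap F L a := by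
  induction n with
  | zero => simp [polyIter]
  | succ n ih =>
    rw [polyIter, aeval_comp, ih, aeval_shiftedDickson, pow_succ 3 n, pow_mul]
    have : z ^ 3 ^ n ≠ 0 := pow_ne_zero _ hz
    field_simp
    ring

open IntermediateField in
theorem irreducible_polyIter_shiftedDickson {F : Type*} [Field F] {a b : F}
    (hab : b + b⁻¹ = a) (hb : ∀ c : F, c ^ 3 ≠ b) (n : ℕ) :
    Irreducible (polyIter (shiftedDickson a) n) := by
  have hb0 : b ≠ 0 := fun h => hb 0 (by simp [h])
  have hirr := X_pow_sub_C_irreducible_of_prime_pow Nat.prime_three (by norm_num) n hb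
  set g : F[X] := X ^ 3 ^ n - C b
  have : Fact (Irreducible g) := ⟨hirr⟩
  have hgdeg : g.natDegree = 3 ^ n := natDegree_X_pow_sub_C
  have : FiniteDimensional F (AdjoinRoot g) := (AdjoinRoot.powerBasis hirr.ne_zero).finite
  have hrank : Module.finrank F (AdjoinRoot g) = 3 ^ n := by
    rw [(AdjoinRoot.powerBasis hirr.ne_zero).finrank, AdjoinRoot.powerBasis_dim, hgdeg]
  set z : AdjoinRoot g := AdjoinRoot.root g
  have hzpow : z ^ 3 ^ n = algebraMap F (AdjoinRoot g) b := by
    have h : aeval z g = 0 := by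
      rw [AdjoinRoot.aeval_eq, AdjoinRoot.mk_self]
    simpa [g, sub_eq_zero] using h
  have hz : z ≠ 0 := by
    rintro h
    rw [h, zero_pow (by positivity)] at hzpow
    exact hb0 ((map_eq_zero _).mp hzpow.symm)
  have hmin := natDegree_minpoly_add_inv hz (adjoin_root_eq_top g)
    (by rw [hrank]; exact Odd.pow (by decide))
  have hroot : aeval (z + z⁻¹ - algebraMap F (AdjoinRoot g) a)
      (polyIter (shiftedDickson a) n) = 0 := by
    rw [aeval_polyIter_shiftedDickson a hz, hzpow, ← hab, map_add, map_inv₀, sub_self]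
  have hint : IsIntegral F (z + z⁻¹ - algebraMap F (AdjoinRoot g) a) := IsIntegral.of_finite F _
  have hP : (polyIter (shiftedDickson a) n).Monic :=
    monic_polyIter (monic_shiftedDickson a) (by simp [natDegree_shiftedDickson]) n
  have heq := eq_of_monic_of_dvd_of_natDegree_le (minpoly.monic hint) hP
    (minpoly.dvd F _ hroot) (by
      rw [natDegree_polyIter, natDegree_shiftedDickson, minpoly.sub_algebraMap, natDegree_comp,
        natDegree_X_add_C, mul_one, hmin, hrank])
  rw [heq]
  exact minpoly.irreducible hint

theorem FiniteField.mem_range_algebraMap_of_pow_card_eq {K L : Type*} [Field K] [Fintype K]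
    [Field L] [Algebra K L] {x : L} (hx : x ^ Fintype.card K = x) :
    x ∈ Set.range (algebraMap K L) := by
  classical
  by_contra hmem
  have hne := FiniteField.X_pow_card_sub_X_ne_zero L (Fintype.one_lt_card (α := K))
  have hcard := card_le_degree_of_subset_roots
    (p := (X ^ Fintype.card K - X : L[X]))
    (Z := insert x (Finset.univ.image (algebraMap K L))) (by
      intro y hy
      rw [Finset.mem_val, Finset.mem_insert, Finset.mem_image] at hy
      rw [mem_roots hne, IsRoot.def, eval_sub, eval_pow, eval_X, sub_eq_zero]
      obtain rfl | ⟨c, -, rfl⟩ := hy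
      · exact hx
      · rw [← map_pow, FiniteField.pow_card])
  rw [FiniteField.X_pow_card_sub_X_natDegree_eq L (Fintype.one_lt_card (α := K)),
    Finset.card_insert_of_notMem (by simpa using hmem),
    Finset.card_image_of_injective _ (algebraMap K L).injective, Finset.card_univ] at hcard
  omega

/-- A cubic `X ^ 3 - 3 * X - α` without roots over a finite field has a square discriminant. -/
theorem exists_sq_eq_discr_of_no_root {K Ω : Type*} [Field K] [Fintype K] [Field Ω] [Algebra K Ω]
    {α : K} (hnoroot : ∀ c : K, c ^ 3 - 3 * c ≠ α) {y : Ω}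
    (hy : y ^ 3 - 3 * y = algebraMap K Ω α) :
    ∃ s : K, s ^ 2 = -27 * (α ^ 2 - 4) := by
  let φ : Ω →ₐ[K] Ω := FiniteField.frobeniusAlgHom K Ω
  have hφ (x : Ω) (hx : φ x = x) : ∃ c : K, algebraMap K Ω c = x :=
    FiniteField.mem_range_algebraMap_of_pow_card_eq hx
  have hno (x : Ω) (hx : φ x = x) : x ^ 3 - 3 * x ≠ algebraMap K Ω α := by
    obtain ⟨c, rfl⟩ := hφ x hx
    intro h
    refine hnoroot c ((algebraMap K Ω).injective ?_)
    rw [← h]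
    simp only [map_sub, map_mul, map_pow, map_ofNat]
  have hstep (x : Ω) (hx : x ^ 3 - 3 * x = algebraMap K Ω α) :
      φ x ^ 3 - 3 * φ x = algebraMap K Ω α := by
    simpa only [map_sub, map_mul, map_pow, map_ofNat, AlgHom.commutes] using congrArg φ hx
  have hpair (x w : Ω) (hx : x ^ 3 - 3 * x = algebraMap K Ω α)
      (hw : w ^ 3 - 3 * w = algebraMap K Ω α) (hne : x ≠ w) : x ^ 2 + x * w + w ^ 2 = 3 :=
    mul_left_cancel₀ (sub_ne_zero.mpr hne) (by linear_combination hx - hw)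
  have hne (x : Ω) (hx : x ^ 3 - 3 * x = algebraMap K Ω α) : x ≠ φ x :=
    fun h => hno x h.symm hx
  have hy₂ := hstep y hy
  have hy₃ := hstep (φ y) hy₂
  have hp := hpair y (φ y) hy hy₂ (hne y hy)
  have hp' := hpair (φ y) (φ (φ y)) hy₂ hy₃ (hne (φ y) hy₂)
  have hne₁₃ : y ≠ φ (φ y) := by
    intro h
    refine hno (-(y + φ y)) ?_ ?_
    · rw [map_neg, map_add, ← h, add_comm]
    · linear_combination hy - (2 * y + φ y) * hp
  have hsum : y + φ y + φ (φ y) = 0 := by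
    refine (mul_eq_zero.mp ?_).resolve_left (sub_ne_zero.mpr hne₁₃)
    linear_combination hp - hp'
  have hsum' : φ y + φ (φ y) + φ (φ (φ y)) = 0 := by simpa using congrArg φ hsum
  have hφ₃ : φ (φ (φ y)) = y := by linear_combination hsum' - hsum
  obtain ⟨s, hs⟩ := hφ ((y - φ y) * (φ y - φ (φ y)) * (φ (φ y) - y)) (by
    simp only [map_mul, map_sub, hφ₃]
    ring)
  refine ⟨s, (algebraMap K Ω).injective ?_⟩
  have h₃ : φ (φ y) = -(y + φ y) := by linear_combination hsum
  rw [map_pow, hs, h₃]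
  simp only [map_mul, map_sub, map_neg, map_pow, map_ofNat, ← hy]
  linear_combination (4 * φ y ^ 4 + 8 * y * φ y ^ 3 - 15 * y ^ 2 * φ y ^ 2 + 12 * φ y ^ 2 -
    19 * y ^ 3 * φ y + 12 * y * φ y + 31 * y ^ 4 - 69 * y ^ 2 + 36) * hp

open IntermediateField in
/-- An irreducible `X ^ 3 - 3 * X - α`, up to translation, has no root in an extension of degree
at most two. -/
theorem not_mem_of_irreducible_shiftedDickson {K Ω : Type*} [Field K] [Field Ω] [Algebra K Ω]
    {α : K} (hirr : Irreducible (shiftedDickson α)) {E : IntermediateField K Ω}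
    (hpos : 0 < Module.finrank K E) (hE : Module.finrank K E ≤ 2) {w : Ω}
    (hw : w ^ 3 - 3 * w = algebraMap K Ω α) : w ∉ E := by
  intro hmem
  have : FiniteDimensional K E := Module.finite_of_finrank_pos hpos
  let u : E := ⟨w, hmem⟩
  have hu : aeval (u - algebraMap K E α) (shiftedDickson α) = 0 := by
    rw [aeval_shiftedDickson, sub_eq_zero]
    exact Subtype.ext hw
  have hdvd := minpoly.degree_dvd (IsIntegral.of_finite K (u - algebraMap K E α))
  rw [← minpoly.eq_of_irreducible_of_monic hirr hu (monic_shiftedDickson α),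
    natDegree_shiftedDickson] at hdvd
  have := Nat.le_of_dvd hpos hdvd
  omega

theorem natCast_ne_zero_of_card_eq_prime_pow {K : Type*} [Field K] [Fintype K] {p s : ℕ}
    (hp : p.Prime) (hcard : Fintype.card K = p ^ s) {m : ℕ} (hm : 0 < m) (hmp : m < p) :
    (m : K) ≠ 0 := by
  have : Fact p.Prime := ⟨hp⟩
  have := charP_of_card_eq_prime_pow hcard
  rw [Ne, CharP.cast_eq_zero_iff K p]
  exact Nat.not_dvd_of_pos_of_lt hm hmp

theorem stmt10 {K Ω : Type*} [Field K] [Fintype K] [Field Ω] [Algebra K Ω]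
    [IsAlgClosure K Ω] {p s : ℕ} (hp : p.Prime) (hp3 : 3 < p) (hs : 0 < s)
    (hcard : Fintype.card K = p ^ s)
    (α : K) (hα : α ≠ 2) (hα' : α ≠ -2)
    (f : K[X])
    (hf : f = X ^ 3 + C (3 * α) * X ^ 2 + C (3 * α ^ 2 - 3) * X + C (α ^ 3 - 4 * α))
    (sqrt3 : Ω) (h3 : sqrt3 ^ 2 = -3)
    (δ : Ω) (hδ : δ ^ 2 = algebraMap K Ω (α ^ 2 - 4)) :
    (∀ n : ℕ, 0 < n → Irreducible (polyIter f n)) ↔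
      ((∃ t : K, t ≠ 0 ∧ t ^ 2 = -3 * (α ^ 2 - 4)) ∧
       (¬ ∃ v : Ω, v ∈ IntermediateField.adjoin K ({sqrt3} : Set Ω) ∧
          v ^ 3 = (algebraMap K Ω α + δ) / 2) ∧
       (¬ ∃ v : Ω, v ∈ IntermediateField.adjoin K ({sqrt3} : Set Ω) ∧
          v ^ 3 = (algebraMap K Ω α - δ) / 2)) := by
  obtain rfl : f = shiftedDickson α := hf
  have : IsAlgClosed Ω := IsAlgClosure.isAlgClosed K
  have h2K : (2 : K) ≠ 0 := by
    exact_mod_cast natCast_ne_zero_of_card_eq_prime_pow hp hcard (m := 2) (by omega) (by omega)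
  have h3K : (3 : K) ≠ 0 := by
    exact_mod_cast natCast_ne_zero_of_card_eq_prime_pow hp hcard (m := 3) (by omega) hp3
  have h2Ω : (2 : Ω) ≠ 0 := by
    rw [← map_ofNat (algebraMap K Ω) 2]
    exact (_root_.map_ne_zero _).mpr h2K
  have h3Ω : (3 : Ω) ≠ 0 := by
    rw [← map_ofNat (algebraMap K Ω) 3]
    exact (_root_.map_ne_zero _).mpr h3K
  have hsqrt : sqrt3 ≠ 0 := by
    rintro rfl
    exact h3Ω (by linear_combination h3)
  rw [map_sub, map_pow, map_ofNat] at hδ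
  have hprod : (algebraMap K Ω α + δ) / 2 * ((algebraMap K Ω α - δ) / 2) = 1 := by
    field_simp
    linear_combination -hδ
  have hsum : (algebraMap K Ω α + δ) / 2 + (algebraMap K Ω α - δ) / 2 = algebraMap K Ω α := by
    field_simp
    ring
  set E := IntermediateField.adjoin K ({sqrt3} : Set Ω)
  constructor
  · intro h
    have hirr : Irreducible (shiftedDickson α) := by simpa [polyIter] using h 1 one_pos
    have hnoroot (c : K) : c ^ 3 - 3 * c ≠ α := by
      intro hc
      refine not_mem_of_irreducible_shiftedDickson (E := (⊥ : IntermediateField K Ω)) hirr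
        (by simp) (by simp) (w := algebraMap K Ω c) ?_ (IntermediateField.algebraMap_mem _ c)
      rw [← hc]
      simp only [map_sub, map_mul, map_pow, map_ofNat]
    have hroot : aeval sqrt3 (X ^ 2 + C 3 : K[X]) = 0 := by
      simp [h3, map_ofNat]
    have hint : IsIntegral K sqrt3 := ⟨_, monic_X_pow_add_C 3 two_ne_zero, hroot⟩
    have hE : Module.finrank K E ≤ 2 := by
      rw [IntermediateField.adjoin.finrank hint,
        ← natDegree_X_pow_add_C (R := K) (n := 2) (r := 3)]
      exact natDegree_le_of_dvd (minpoly.dvd K sqrt3 hroot)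
        (monic_X_pow_add_C 3 two_ne_zero).ne_zero
    have hpos : 0 < Module.finrank K E := by
      rw [IntermediateField.adjoin.finrank hint]
      exact minpoly.natDegree_pos hint
    have hcube {β β' : Ω} (hmul : β * β' = 1) (hadd : β + β' = algebraMap K Ω α) :
        ¬ ∃ v : Ω, v ∈ E ∧ v ^ 3 = β := by
      rintro ⟨v, hv, rfl⟩
      have hv0 : v ≠ 0 := by
        rintro rfl
        simp at hmul
      refine not_mem_of_irreducible_shiftedDickson hirr hpos hE ?_ (E.add_mem hv (E.inv_mem hv))
      rw [← hadd, eq_inv_of_mul_eq_one_right hmul]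
      field_simp
      ring
    refine ⟨?_, hcube hprod hsum, hcube ((mul_comm _ _).trans hprod) ((add_comm _ _).trans hsum)⟩
    obtain ⟨x, hx⟩ := IsAlgClosed.exists_aeval_eq_zero Ω (shiftedDickson α)
      (degree_ne_of_natDegree_ne (n := 0) (by simp [natDegree_shiftedDickson]))
    have hy := aeval_shiftedDickson α (x + algebraMap K Ω α)
    rw [add_sub_cancel_right, hx] at hy
    obtain ⟨s, hs⟩ := exists_sq_eq_discr_of_no_root hnoroot (sub_eq_zero.mp hy.symm)
    have ht : (s / 3) ^ 2 = -3 * (α ^ 2 - 4) := by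
      rw [div_pow, hs]
      field_simp
      ring
    refine ⟨s / 3, ?_, ht⟩
    intro h0
    rw [h0] at ht
    have hz : 3 * ((α - 2) * (α + 2)) = 0 := by linear_combination ht
    simp only [mul_eq_zero, h3K, false_or] at hz
    rcases hz with hz | hz
    · exact hα (sub_eq_zero.mp hz)
    · exact hα' (eq_neg_of_add_eq_zero_left hz)
  · rintro ⟨⟨t, -, ht⟩, hcube, -⟩ n -
    have hδE : δ ∈ E := by
      have hs : sqrt3 ∈ E := IntermediateField.mem_adjoin_simple_self K sqrt3
      have hq : algebraMap K Ω t / sqrt3 ∈ E := E.div_mem (E.algebraMap_mem t) hs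
      have hsq : δ ^ 2 = (algebraMap K Ω t / sqrt3) ^ 2 := by
        rw [div_pow, ← map_pow, ht, h3, hδ]
        simp only [map_sub, map_mul, map_pow, map_ofNat, map_neg]
        field_simp
      rcases sq_eq_sq_iff_eq_or_eq_neg.mp hsq with h | h
      · exact h ▸ hq
      · exact h ▸ E.neg_mem hq
    let b : E := ⟨(algebraMap K Ω α + δ) / 2,
      E.div_mem (E.add_mem (E.algebraMap_mem α) hδE) (ofNat_mem E 2)⟩
    have hab : b + b⁻¹ = algebraMap K E α := by
      apply Subtype.ext
      change (algebraMap K Ω α + δ) / 2 + ((algebraMap K Ω α + δ) / 2)⁻¹ = algebraMap K Ω α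
      rw [← eq_inv_of_mul_eq_one_right hprod, hsum]
    have hirr := irreducible_polyIter_shiftedDickson hab
      (fun c hc => hcube ⟨c, c.2, congrArg Subtype.val hc⟩) n
    refine Monic.irreducible_of_irreducible_map (algebraMap K E) _
      (monic_polyIter (monic_shiftedDickson α) (by simp [natDegree_shiftedDickson]) n) ?_
    rw [map_polyIter]
    convert hirr using 2
    simp [shiftedDickson, map_ofNat]
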